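/- An Archimedean vector lattice F is atomic (every g > 0 dominates an atom) if and only if F is order locally pre-compact, i.e., every filter on F that order converges to some element of F contains an order pre-compact subset of F. -/

import Mathlib

/-- A filter `G` on a lattice order converges to `p` if it contains a family of
order intervals whose intersection equals `{p}`. -/
def OrderConvergesTo {F : Type*} [Lattice F] (G : Filter F) (p : F) : Prop :=
  ∃ S : Set (F × F),
    (∀ q ∈ S, q.1 ≤ q.2) ∧
    (∀ q ∈ S, Set.Icc q.1 q.2 ∈ G) ∧
    (⋂ q ∈ S, Set.Icc q.1 q.2) = {p}

/-- A filter `G` is order Cauchy if the pushforward of `G ×ˢ G` under `(x, y) ↦ x - y`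
order converges to `0`. -/
def OrderCauchy {F : Type*} [Lattice F] [AddCommGroup F] (G : Filter F) : Prop :=
  OrderConvergesTo (Filter.map (fun q : F × F => q.1 - q.2) (G ×ˢ G)) (0 : F)

/-- A subset `S` is order pre-compact if every ultrafilter containing `S` is order Cauchy. -/
def OrderPreCompact {F : Type*} [Lattice F] [AddCommGroup F] (S : Set F) : Prop :=
  ∀ U : Ultrafilter F, S ∈ U → OrderCauchy (U : Filter F)

/-- An atom of a vector lattice: a positive element all of whose order-subelements are
scalar multiples of it. -/
def IsVLAtom {F : Type*} [Lattice F] [AddCommGroup F] [Module ℝ F] (a : F) : Prop :=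
  0 < a ∧ ∀ b : F, 0 ≤ b → b ≤ a → ∃ t : ℝ, b = t • a

open Filter Set

theorem inf_eq_zero_of_le {F : Type*} [Lattice F] [Zero F] {a b c d : F}
    (ha : 0 ≤ a) (hb : 0 ≤ b) (hac : a ≤ c) (hbd : b ≤ d)
    (h : c ⊓ d = 0) : a ⊓ b = 0 :=
  le_antisymm ((inf_le_inf hac hbd).trans h.le) (le_inf ha hb)

theorem OrderConvergesTo.exists_Icc_mem {F : Type*} [Lattice F] {G : Filter F} {p : F}
    (hG : OrderConvergesTo G p) :
    ∃ u v : F, u ≤ v ∧ Icc u v ∈ G := by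
  obtain ⟨S, hle, hmem, hS⟩ := hG
  rcases S.eq_empty_or_nonempty with rfl | ⟨q, hq⟩
  · refine ⟨p, p, le_rfl, ?_⟩
    rw [Icc_self, ← hS]
    simp
  · exact ⟨q.1, q.2, hle q hq, hmem q hq⟩

theorem OrderPreCompact.mono {F : Type*} [Lattice F] [AddCommGroup F] {S T : Set F}
    (hT : OrderPreCompact T) (hST : S ⊆ T) : OrderPreCompact S :=
  fun U hU => hT U (mem_of_superset hU hST)

/-- If every positive element below `h` dominates two disjoint positive ones,
finitely many positive elements below `h` can be shrunk to pairwise disjoint ones. -/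
theorem exists_pairwise_disjoint_refinement {F ι : Type*} [Lattice F] [Zero F] {h : F}
    (hsplit : ∀ c : F, 0 < c → c ≤ h → ∃ c₁ c₂ : F, 0 < c₁ ∧ c₁ ≤ c ∧ 0 < c₂ ∧ c₂ ≤ c ∧
      c₁ ⊓ c₂ = 0)
    (s : Finset ι) (p : ι → F) (hp : ∀ i ∈ s, 0 < p i ∧ p i ≤ h) :
    ∃ q : ι → F, (∀ i ∈ s, 0 < q i ∧ q i ≤ p i) ∧
      ∀ i ∈ s, ∀ j ∈ s, i ≠ j → q i ⊓ q j = 0 := by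
  classical
  induction s using Finset.induction_on with
  | empty => exact ⟨p, by simp, by simp⟩
  | insert j s hj ih =>
    rw [Finset.forall_mem_insert] at hp
    obtain ⟨q, hq, hd⟩ := ih hp.2
    have hne : ∀ i ∈ s, i ≠ j := fun i hi hij => hj (hij ▸ hi)
    by_cases hdis : ∀ i ∈ s, p j ⊓ q i = 0
    · refine ⟨Function.update q j (p j), ?_, ?_⟩
      · rw [Finset.forall_mem_insert]
        refine ⟨by simpa using hp.1.1, fun i hi => ?_⟩
        rw [Function.update_of_ne (hne i hi)]
        exact hq i hi
      · intro i hi k hk hik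
        rw [Finset.mem_insert] at hi hk
        rcases hi with rfl | hi <;> rcases hk with rfl | hk
        · exact absurd rfl hik
        · rw [Function.update_self, Function.update_of_ne (hne k hk)]
          exact hdis k hk
        · rw [Function.update_self, Function.update_of_ne (hne i hi), inf_comm]
          exact hdis i hi
        · rw [Function.update_of_ne (hne i hi), Function.update_of_ne (hne k hk)]
          exact hd i hi k hk hik
    · push Not at hdis
      obtain ⟨i₀, hi₀, hne₀⟩ := hdis
      have hc : 0 < p j ⊓ q i₀ := lt_of_le_of_ne (le_inf hp.1.1.le (hq i₀ hi₀).1.le) hne₀.symm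
      obtain ⟨c₁, c₂, h1, h1c, h2, h2c, h12⟩ := hsplit _ hc (inf_le_left.trans hp.1.2)
      have hq₁ : c₁ ≤ q i₀ := h1c.trans inf_le_right
      have hq₂ : c₂ ≤ q i₀ := h2c.trans inf_le_right
      set q' : ι → F := Function.update (Function.update q i₀ c₁) j c₂ with hq'
      have hqj : q' j = c₂ := by simp [hq']
      have hqi₀ : q' i₀ = c₁ := by simp [hq', hne i₀ hi₀]
      have hqi : ∀ i ∈ s, i ≠ i₀ → q' i = q i := fun i hi h => by simp [hq', hne i hi, h]
      have hpos : ∀ i ∈ s, 0 < q' i ∧ q' i ≤ q i := fun i hi => by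
        by_cases h : i = i₀
        · subst h; rw [hqi₀]; exact ⟨h1, hq₁⟩
        · rw [hqi i hi h]; exact ⟨(hq i hi).1, le_rfl⟩
      have hdj : ∀ i ∈ s, q' i ⊓ q' j = 0 := fun i hi => by
        by_cases h : i = i₀
        · subst h; rw [hqi₀, hqj, h12]
        · rw [hqj]
          exact inf_eq_zero_of_le (hpos i hi).1.le h2.le (hpos i hi).2 hq₂ (hd i hi i₀ hi₀ h)
      refine ⟨q', ?_, ?_⟩
      · rw [Finset.forall_mem_insert, hqj]
        exact ⟨⟨h2, h2c.trans inf_le_left⟩,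
          fun i hi => ⟨(hpos i hi).1, (hpos i hi).2.trans (hq i hi).2⟩⟩
      · intro i hi k hk hik
        rw [Finset.mem_insert] at hi hk
        rcases hi with rfl | hi <;> rcases hk with rfl | hk
        · exact absurd rfl hik
        · rw [inf_comm]; exact hdj k hk
        · exact hdj i hi
        · exact inf_eq_zero_of_le (hpos i hi).1.le (hpos k hk).1.le (hpos i hi).2 (hpos k hk).2
            (hd i hi k hk hik)

section Disjointness

variable {F : Type*} [Lattice F] [AddCommGroup F] [IsOrderedAddMonoid F]

theorem inf_add_le_inf_add_inf {r a b : F} (hr : 0 ≤ r) (ha : 0 ≤ a) (hb : 0 ≤ b) :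
    r ⊓ (a + b) ≤ r ⊓ a + r ⊓ b := by
  rw [add_inf, inf_add, inf_add]
  refine le_inf (le_inf ?_ ?_) (le_inf ?_ ?_)
  · exact inf_le_left.trans (le_add_of_nonneg_left hr)
  · exact inf_le_left.trans (le_add_of_nonneg_left ha)
  · exact inf_le_left.trans (le_add_of_nonneg_right hb)
  · exact inf_le_right

theorem inf_add_eq_zero {r a b : F} (hr : 0 ≤ r) (ha : 0 ≤ a) (hb : 0 ≤ b)
    (hra : r ⊓ a = 0) (hrb : r ⊓ b = 0) : r ⊓ (a + b) = 0 := by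
  refine le_antisymm ?_ (le_inf hr (add_nonneg ha hb))
  simpa [hra, hrb] using inf_add_le_inf_add_inf hr ha hb

theorem inf_nsmul_eq_zero {r a : F} (hr : 0 ≤ r) (ha : 0 ≤ a) (h : r ⊓ a = 0) (n : ℕ) :
    r ⊓ n • a = 0 := by
  induction n with
  | zero => simpa using hr
  | succ n ih =>
    rw [succ_nsmul]
    exact inf_add_eq_zero hr (nsmul_nonneg ha n) ha ih h

theorem inf_sum_eq_zero {ι : Type*} {r : F} (hr : 0 ≤ r) (s : Finset ι) (f : ι → F)
    (hf : ∀ i ∈ s, 0 ≤ f i) (h : ∀ i ∈ s, r ⊓ f i = 0) : r ⊓ ∑ i ∈ s, f i = 0 := by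
  classical
  induction s using Finset.induction_on with
  | empty => simpa using hr
  | insert i s hi ih =>
    rw [Finset.sum_insert hi]
    simp only [Finset.forall_mem_insert] at hf h
    exact inf_add_eq_zero hr hf.1 (Finset.sum_nonneg hf.2) h.1 (ih hf.2 h.2)

theorem eq_zero_of_abs_nonpos {x : F} (h : |x| ≤ 0) : x = 0 :=
  le_antisymm ((le_abs_self x).trans h) (neg_nonpos.1 ((neg_le_abs x).trans h))

theorem abs_le_of_mem_Icc_neg {x b : F} (h : x ∈ Icc (-b) b) : |x| ≤ b :=
  abs_le'.2 ⟨h.2, neg_le.1 h.1⟩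

theorem sub_sup_zero_inf_sub_sup_zero (a b : F) : ((a - b) ⊔ 0) ⊓ ((b - a) ⊔ 0) = 0 := by
  have h := posPart_inf_negPart_eq_zero (a - b)
  rwa [posPart_def, negPart_def, neg_sub] at h

theorem sub_sup_zero_pos {a b : F} (h : ¬ a ≤ b) : 0 < (a - b) ⊔ 0 :=
  lt_of_le_of_ne le_sup_right fun h0 => h <| sub_nonpos.1 <| le_sup_left.trans h0.symm.le

/-- In an Archimedean lattice-ordered group, if the elements below `h` can be split, then `[0, h]`
is not covered by finitely many sets, written here as complements, such that the differences
within each set have an upper bound not above `h`. -/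
theorem exists_mem_forall_of_split {h : F} (hh : 0 < h)
    (harch : ∀ x y : F, (∀ n : ℕ, 0 ≤ n • x ∧ n • x ≤ y) → x = 0)
    (hsplit : ∀ c : F, 0 < c → c ≤ h → ∃ c₁ c₂ : F, 0 < c₁ ∧ c₁ ≤ c ∧ 0 < c₂ ∧ c₂ ≤ c ∧
      c₁ ⊓ c₂ = 0)
    (T : Finset (Set F))
    (hT : ∀ B ∈ T, ∃ v : F, 0 ≤ v ∧ ¬ h ≤ v ∧
      ∀ x ∈ Icc 0 h \ B, ∀ y ∈ Icc 0 h \ B, x - y ≤ v) :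
    ∃ f : F, ∀ B ∈ T, f ∈ B := by
  classical
  choose! v hv0 hhv hv using hT
  obtain ⟨q, hq, hd⟩ := exists_pairwise_disjoint_refinement hsplit T
    (fun B => (h - v B) ⊔ 0) fun B hB =>
      ⟨sub_sup_zero_pos (hhv B hB), sup_le (sub_le_self _ (hv0 B hB)) hh.le⟩
  have hn : ∀ B ∈ T, ∃ n : ℕ, ¬ n • q B ≤ h := fun B hB => by
    by_contra! hcon
    exact (hq B hB).1.ne' (harch _ h fun n => ⟨nsmul_nonneg (hq B hB).1.le n, hcon n⟩)
  choose! n hn using hn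
  set r : Set F → F := fun B => (n B • q B - h) ⊔ 0 with hr
  have hr0 : ∀ B, 0 ≤ r B := fun B => le_sup_right
  have hnq : ∀ B ∈ T, 0 ≤ n B • q B := fun B hB => nsmul_nonneg (hq B hB).1.le _
  have hrq : ∀ B ∈ T, r B ≤ n B • q B := fun B hB =>
    sup_le (sub_le_self _ hh.le) (hnq B hB)
  set σ : Finset (Set F) := T.filter fun B => ∃ x ∈ Icc 0 h \ B, r B ⊓ x = 0 with hσ
  have hσT : ∀ B ∈ σ, B ∈ T := fun B hB => (Finset.mem_filter.1 hB).1
  have hsum : 0 ≤ ∑ B ∈ σ, n B • q B := Finset.sum_nonneg fun B hB => hnq B (hσT B hB)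
  set f : F := h ⊓ ∑ B ∈ σ, n B • q B with hf
  have hf0 : 0 ≤ f := le_inf hh.le hsum
  have hfh : f ≤ h := inf_le_left
  refine ⟨f, fun B hB => ?_⟩
  by_contra hfB
  by_cases hBσ : B ∈ σ
  · obtain ⟨x, hx, hrx⟩ := (Finset.mem_filter.1 hBσ).2
    have hrf : r B ⊓ (h - f) = 0 := by
      refine inf_eq_zero_of_le (hr0 B) (sub_nonneg.2 hfh) le_rfl ?_
        (sub_sup_zero_inf_sub_sup_zero (n B • q B) h)
      have h1 : h ⊓ n B • q B ≤ f := inf_le_inf_left _ <|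
        Finset.single_le_sum (f := fun B => n B • q B) (fun C hC => hnq C (hσT C hC)) hBσ
      calc h - f ≤ h - h ⊓ n B • q B := sub_le_sub_left h1 _
        _ = (h - n B • q B) ⊔ 0 := by rw [sub_inf, sub_self, sup_comm]
    have hle : (h - v B) ⊔ 0 ≤ (h - f) + x := by
      refine sup_le ?_ (add_nonneg (sub_nonneg.2 hfh) hx.1.1)
      calc h - v B ≤ h - (f - x) := sub_le_sub_left (hv B hB f ⟨⟨hf0, hfh⟩, hfB⟩ x hx) _
        _ = (h - f) + x := by abel
    have hrs := inf_add_eq_zero (hr0 B) (sub_nonneg.2 hfh) hx.1.1 hrf hrx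
    have hrqB : r B ⊓ q B = 0 :=
      inf_eq_zero_of_le (hr0 B) (hq B hB).1.le le_rfl ((hq B hB).2.trans hle) hrs
    have := inf_nsmul_eq_zero (hr0 B) (hq B hB).1.le hrqB (n B)
    rw [inf_eq_left.2 (hrq B hB)] at this
    exact (sub_sup_zero_pos (hn B hB)).ne' this
  · refine hBσ (Finset.mem_filter.2 ⟨hB, f, ⟨⟨hf0, hfh⟩, hfB⟩, ?_⟩)
    refine inf_eq_zero_of_le (hr0 B) hf0 (hrq B hB) inf_le_right ?_
    refine inf_sum_eq_zero (hnq B hB) _ _ (fun C hC => hnq C (hσT C hC)) fun C hC => ?_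
    have hBC : B ≠ C := fun hBC => hBσ (hBC ▸ hC)
    refine inf_nsmul_eq_zero (hnq B hB) (hq C (hσT C hC)).1.le ?_ _
    rw [inf_comm]
    exact inf_nsmul_eq_zero (hq C (hσT C hC)).1.le (hq B hB).1.le
      (hd C (hσT C hC) B hB hBC.symm) _

/-- If the elements below `h` can be split, then `[0, h]` is not order pre-compact. -/
theorem not_orderPreCompact_Icc_of_split {h : F} (hh : 0 < h)
    (harch : ∀ x y : F, (∀ n : ℕ, 0 ≤ n • x ∧ n • x ≤ y) → x = 0)
    (hsplit : ∀ c : F, 0 < c → c ≤ h → ∃ c₁ c₂ : F, 0 < c₁ ∧ c₁ ≤ c ∧ 0 < c₂ ∧ c₂ ≤ c ∧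
      c₁ ⊓ c₂ = 0) :
    ¬ OrderPreCompact (Icc 0 h) := by
  intro hpc
  obtain ⟨U, hU⟩ := Ultrafilter.exists_ultrafilter_of_finite_inter_nonempty
    {B : Set F | ∃ v : F, 0 ≤ v ∧ ¬ h ≤ v ∧
      ∀ x ∈ Icc 0 h \ B, ∀ y ∈ Icc 0 h \ B, x - y ≤ v} fun T hT => by
    obtain ⟨f, hf⟩ := exists_mem_forall_of_split hh harch hsplit T fun B hB => hT hB
    exact ⟨f, fun B hB => hf B hB⟩
  have hIcc : Icc 0 h ∈ U := hU ⟨0, le_rfl, hh.not_ge, by simp⟩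
  obtain ⟨S, -, hSG, hS⟩ := hpc U hIcc
  have hhS : h ∉ ⋂ q ∈ S, Icc q.1 q.2 := by
    rw [hS]; exact hh.ne'
  have h0S : (0 : F) ∈ ⋂ q ∈ S, Icc q.1 q.2 := by rw [hS]; rfl
  rw [mem_iInter₂] at h0S
  simp only [mem_iInter, not_forall] at hhS
  obtain ⟨q, hqS, hhq⟩ := hhS
  obtain ⟨A₁, hA₁, A₂, hA₂, hA⟩ := mem_prod_iff.1 (mem_map.1 (hSG q hqS))
  have hmem : (A₁ ∩ A₂)ᶜ ∈ U := by
    refine hU ⟨q.2, (h0S q hqS).2, fun hle => hhq ⟨(h0S q hqS).1.trans hh.le, hle⟩, ?_⟩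
    rintro x ⟨-, hx⟩ y ⟨-, hy⟩
    rw [notMem_compl_iff] at hx hy
    exact (hA (mk_mem_prod hx.1 hy.2)).2
  exact Ultrafilter.compl_notMem_iff.2 (inter_mem hA₁ hA₂) hmem

end Disjointness

section Archimedean

variable {F : Type*} [Lattice F] [AddCommGroup F] [IsOrderedAddMonoid F] [Module ℝ F]
  [IsOrderedModule ℝ F]

theorem le_of_smul_le_smul_of_pos {s t : ℝ} {a : F} (ha : 0 < a) (hst : s • a ≤ t • a) :
    s ≤ t := by
  by_contra! hts
  have h1 : (s - t) • a ≤ 0 := by rwa [sub_smul, sub_nonpos]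
  have h2 := smul_le_smul_of_nonneg_left h1 (inv_nonneg.2 (sub_pos.2 hts).le)
  rw [inv_smul_smul₀ (sub_pos.2 hts).ne', smul_zero] at h2
  exact ha.not_ge h2

theorem eq_zero_of_forall_abs_le_smul
    (harch : ∀ x y : F, (∀ n : ℕ, 0 ≤ n • x ∧ n • x ≤ y) → x = 0) {x y : F} (hy : 0 ≤ y)
    (hxy : ∀ ε : ℝ, 0 < ε → |x| ≤ ε • y) : x = 0 := by
  refine eq_zero_of_abs_nonpos (le_of_eq ?_)
  refine harch _ y fun n => ⟨nsmul_nonneg (abs_nonneg x) n, ?_⟩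
  rcases n.eq_zero_or_pos with rfl | hn
  · simpa using hy
  · have hn' : (0 : ℝ) < n := by exact_mod_cast hn
    have := smul_le_smul_of_nonneg_left (hxy (n : ℝ)⁻¹ (inv_pos.2 hn')) hn'.le
    rwa [smul_inv_smul₀ hn'.ne', Nat.cast_smul_eq_nsmul] at this

/-- A positive element which is not an atom dominates two disjoint positive elements. -/
theorem exists_disjoint_of_not_atom
    (harch : ∀ x y : F, (∀ n : ℕ, 0 ≤ n • x ∧ n • x ≤ y) → x = 0) {c : F} (hc : 0 < c)
    (hna : ¬ IsVLAtom c) :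
    ∃ c₁ c₂ : F, 0 < c₁ ∧ c₁ ≤ c ∧ 0 < c₂ ∧ c₂ ≤ c ∧ c₁ ⊓ c₂ = 0 := by
  obtain ⟨b, hb0, hbc, hb⟩ : ∃ b : F, 0 ≤ b ∧ b ≤ c ∧ ∀ t : ℝ, b ≠ t • c := by
    simpa [IsVLAtom, hc] using hna
  obtain ⟨t, ht1, ht2⟩ : ∃ t : ℝ, ¬ b ≤ t • c ∧ ¬ t • c ≤ b := by
    by_contra! hcon
    set A : Set ℝ := {t | t • c ≤ b} with hA
    have hbdd : BddAbove A := ⟨1, fun t ht =>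
      le_of_smul_le_smul_of_pos hc (by simpa using le_trans ht hbc)⟩
    have hne : A.Nonempty := ⟨0, by simpa [hA] using hb0⟩
    refine hb (sSup A) (sub_eq_zero.1 ?_)
    refine eq_zero_of_forall_abs_le_smul harch hc.le fun ε hε => abs_le'.2 ⟨?_, ?_⟩
    · rw [sub_le_iff_le_add, ← add_smul]
      by_contra hlt
      have := le_csSup hbdd (hcon _ hlt)
      linarith
    · obtain ⟨t, ht, hlt⟩ := exists_lt_of_lt_csSup hne (sub_lt_self (sSup A) hε)
      rw [neg_sub, sub_le_comm, ← sub_smul]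
      exact (smul_le_smul_of_nonneg_right hlt.le hc.le).trans ht
  have ht0 : 0 ≤ t := by
    by_contra! ht
    exact ht2 ((smul_nonpos_of_nonpos_of_nonneg ht.le hc.le).trans hb0)
  have ht1' : t ≤ 1 := by
    by_contra! ht
    refine ht1 (hbc.trans ?_)
    simpa using smul_le_smul_of_nonneg_right ht.le hc.le
  have htc : t • c ≤ c := by simpa using smul_le_smul_of_nonneg_right ht1' hc.le
  exact ⟨(b - t • c) ⊔ 0, (t • c - b) ⊔ 0, sub_sup_zero_pos ht1,
    sup_le ((sub_le_self _ (smul_nonneg ht0 hc.le)).trans hbc) hc.le, sub_sup_zero_pos ht2,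
    sup_le ((sub_le_self _ hb0).trans htc) hc.le, sub_sup_zero_inf_sub_sup_zero _ _⟩

/-- Relatively uniform neighbourhoods of `0` shrink to `0`. -/
theorem orderConvergesTo_iInf_principal_Icc
    (harch : ∀ x y : F, (∀ n : ℕ, 0 ≤ n • x ∧ n • x ≤ y) → x = 0) {g : F} (hg : 0 ≤ g) :
    OrderConvergesTo
      (⨅ n : ℕ, 𝓟 (Icc (-((n + 1 : ℝ)⁻¹ • g)) ((n + 1 : ℝ)⁻¹ • g))) (0 : F) := by
  have hpos : ∀ n : ℕ, 0 ≤ (n + 1 : ℝ)⁻¹ • g := fun n => smul_nonneg (by positivity) hg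
  refine ⟨range fun n : ℕ => (-((n + 1 : ℝ)⁻¹ • g), (n + 1 : ℝ)⁻¹ • g), ?_, ?_, ?_⟩
  · rintro _ ⟨n, rfl⟩
    exact neg_le_self (hpos n)
  · rintro _ ⟨n, rfl⟩
    exact mem_iInf_of_mem n (mem_principal_self _)
  · ext z
    simp only [mem_iInter, forall_mem_range, mem_singleton_iff]
    refine ⟨fun hz => ?_, ?_⟩
    · refine eq_zero_of_forall_abs_le_smul harch hg fun ε hε => ?_
      obtain ⟨n, hn⟩ := exists_nat_one_div_lt hε
      rw [one_div] at hn
      exact (abs_le_of_mem_Icc_neg (hz n)).trans (smul_le_smul_of_nonneg_right hn.le hg)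
    · rintro rfl n
      exact ⟨neg_nonpos.2 (hpos n), hpos n⟩

theorem exists_atom_le_of_orderLocallyPreCompact
    (harch : ∀ x y : F, (∀ n : ℕ, 0 ≤ n • x ∧ n • x ≤ y) → x = 0)
    (hF : ∀ (G : Filter F) (p : F), OrderConvergesTo G p → ∃ S ∈ G, OrderPreCompact S)
    {g : F} (hg : 0 < g) : ∃ a : F, IsVLAtom a ∧ a ≤ g := by
  by_contra! hna
  obtain ⟨S, hS, hpc⟩ := hF _ _ (orderConvergesTo_iInf_principal_Icc harch hg.le)
  have hanti : ∀ {m n : ℕ}, m ≤ n → (n + 1 : ℝ)⁻¹ • g ≤ (m + 1 : ℝ)⁻¹ • g := fun hmn =>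
    smul_le_smul_of_nonneg_right (by gcongr) hg.le
  rw [mem_iInf_of_directed] at hS
  · obtain ⟨n, hn⟩ := hS
    rw [mem_principal] at hn
    have hn0 : (0 : ℝ) < (n + 1 : ℝ)⁻¹ := by positivity
    set h := (n + 1 : ℝ)⁻¹ • g with hh
    have h0 : 0 ≤ h := smul_nonneg hn0.le hg.le
    have hpos : 0 < h := lt_of_le_of_ne h0 fun he =>
      hg.ne' ((smul_eq_zero.1 he.symm).resolve_left hn0.ne')
    have hhg : h ≤ g := by simpa using hanti n.zero_le
    exact not_orderPreCompact_Icc_of_split hpos harch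
      (fun c hc hch => exists_disjoint_of_not_atom harch hc fun hca => hna c hca (hch.trans hhg))
      (hpc.mono ((Icc_subset_Icc_left (neg_nonpos.2 h0)).trans hn))
  · refine directed_of_isDirected_le fun m n hmn => ?_
    exact principal_mono.2 (Icc_subset_Icc (neg_le_neg (hanti hmn)) (hanti hmn))

/-- For an ultrafilter on an order interval and an atom `a`, the differences are eventually
bounded by an element that does not dominate `a`. -/
theorem exists_bound_sub_not_ge_atom
    (harch : ∀ x y : F, (∀ n : ℕ, 0 ≤ n • x ∧ n • x ≤ y) → x = 0) {u v a : F} (huv : u ≤ v)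
    (ha : IsVLAtom a) (U : Ultrafilter F) (hU : Icc u v ∈ U) :
    ∃ b : F, 0 ≤ b ∧ ¬ a ≤ b ∧ ∃ A ∈ U, ∀ x ∈ A, ∀ y ∈ A, x - y ≤ b := by
  classical
  obtain ⟨ha0, hatom⟩ := ha
  have hex : ∃ k : ℕ, ¬ ((k : ℝ) / 2) • a ≤ v - u := by
    by_contra! hcon
    refine ha0.ne' ?_
    have h2 : (1 / 2 : ℝ) • a = 0 := harch _ (v - u) fun n => by
      rw [← Nat.cast_smul_eq_nsmul ℝ, smul_smul, mul_one_div]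
      exact ⟨smul_nonneg (by positivity) ha0.le, hcon n⟩
    exact (smul_eq_zero.1 h2).resolve_left (by norm_num)
  obtain ⟨c, hc0, hcle, hcn⟩ : ∃ c : ℝ, 0 ≤ c ∧ c • a ≤ v - u ∧ ¬ (c + 1 / 2) • a ≤ v - u := by
    obtain ⟨k, hk⟩ : ∃ k, Nat.find hex = k + 1 := Nat.exists_eq_succ_of_ne_zero fun h0 =>
      Nat.find_spec hex (by simpa [h0] using huv)
    refine ⟨k / 2, by positivity, ?_, ?_⟩
    · exact not_not.1 (Nat.find_min hex (m := k) (by omega))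
    · have := Nat.find_spec hex
      rwa [hk, Nat.cast_succ, add_div] at this
  have hca : 0 ≤ c • a := smul_nonneg hc0 ha0.le
  have hcoord : ∀ x ∈ Icc u v, ∃ t ∈ Icc (0 : ℝ) c, (x - u) ⊓ c • a = t • a := by
    intro x hx
    have hxu : 0 ≤ (x - u) ⊓ c • a := le_inf (sub_nonneg.2 hx.1) hca
    rcases hc0.eq_or_lt with rfl | hcpos
    · exact ⟨0, by simp, by simpa using hx.1⟩
    · obtain ⟨t, ht⟩ := hatom (c⁻¹ • ((x - u) ⊓ c • a)) (smul_nonneg (inv_nonneg.2 hc0) hxu) (by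
        simpa [inv_smul_smul₀ hcpos.ne'] using smul_le_smul_of_nonneg_left
          (inf_le_right : (x - u) ⊓ c • a ≤ _) (inv_nonneg.2 hc0))
      have hta : (x - u) ⊓ c • a = (c * t) • a := by
        rw [mul_smul, ← ht, smul_inv_smul₀ hcpos.ne']
      rw [hta] at hxu
      exact ⟨c * t, ⟨le_of_smul_le_smul_of_pos ha0 (by simpa using hxu),
        le_of_smul_le_smul_of_pos ha0 (hta.symm.le.trans inf_le_right)⟩, hta⟩
  choose! t ht htx using hcoord
  obtain ⟨l, -, hl⟩ := isCompact_iff_ultrafilter_le_nhds.1 (isCompact_Icc (a := (0 : ℝ)) (b := c))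
    (U.map t) (le_principal_iff.2 (mem_map.2 (mem_of_superset hU ht)))
  have hball : t ⁻¹' Metric.ball l (1 / 4) ∈ U := hl (Metric.ball_mem_nhds l (by norm_num))
  refine ⟨v - u - c • a + (1 / 2 : ℝ) • a,
    add_nonneg (sub_nonneg.2 hcle) (smul_nonneg (by norm_num) ha0.le), fun hle => hcn ?_,
    _, inter_mem hU hball, ?_⟩
  · have h1 : (c + 1 / 2) • a = a - (1 / 2 : ℝ) • a + c • a := by module
    rw [h1]
    calc a - (1 / 2 : ℝ) • a + c • a
        ≤ (v - u - c • a + (1 / 2 : ℝ) • a) - (1 / 2 : ℝ) • a + c • a := by gcongr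
      _ = v - u := by abel
  · rintro x ⟨hx, hxl⟩ y ⟨hy, hyl⟩
    have hxt : x - u ≤ v - u - c • a + t x • a := by
      rw [← htx x hx, add_inf]
      refine le_inf ?_ ?_
      · exact le_add_of_nonneg_left (sub_nonneg.2 hcle)
      · rw [sub_add_cancel]
        exact sub_le_sub_right hx.2 u
    have hyt : t y • a ≤ y - u := by
      rw [← htx y hy]
      exact inf_le_left
    have htt : t x - t y ≤ 1 / 2 := by
      rw [mem_preimage, Metric.mem_ball, Real.dist_eq, abs_lt] at hxl hyl
      linarith
    calc x - y = (x - u) - (y - u) := by abel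
      _ ≤ (v - u - c • a + t x • a) - t y • a := sub_le_sub hxt hyt
      _ = v - u - c • a + (t x - t y) • a := by rw [sub_smul]; abel
      _ ≤ _ := by gcongr

theorem orderPreCompact_Icc_of_atomic
    (harch : ∀ x y : F, (∀ n : ℕ, 0 ≤ n • x ∧ n • x ≤ y) → x = 0)
    (hF : ∀ g : F, 0 < g → ∃ a : F, IsVLAtom a ∧ a ≤ g) {u v : F} (huv : u ≤ v) :
    OrderPreCompact (Icc u v) := by
  intro U hU
  refine ⟨{q | ∃ b : F, q = (-b, b) ∧ 0 ≤ b ∧ ∃ A ∈ U, ∀ x ∈ A, ∀ y ∈ A, x - y ≤ b}, ?_, ?_, ?_⟩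
  · rintro _ ⟨b, rfl, hb, -⟩
    exact neg_le_self hb
  · rintro _ ⟨b, rfl, -, A, hA, hAb⟩
    refine mem_map.2 (mem_of_superset (prod_mem_prod hA hA) ?_)
    rintro ⟨x, y⟩ ⟨hx, hy⟩
    exact ⟨neg_le.1 (by simpa using hAb y hy x hx), hAb x hx y hy⟩
  · refine Subset.antisymm (fun z hz => ?_) ?_
    · rw [mem_iInter₂] at hz
      by_contra hz0
      obtain ⟨a, ha, haz⟩ := hF |z|
        ((abs_nonneg z).lt_of_not_ge fun h => hz0 (eq_zero_of_abs_nonpos h))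
      obtain ⟨b, hb, hab, hA⟩ := exists_bound_sub_not_ge_atom harch huv ha U hU
      exact hab (haz.trans (abs_le_of_mem_Icc_neg (hz _ ⟨b, rfl, hb, hA⟩)))
    · rintro _ rfl
      refine mem_iInter₂.2 ?_
      rintro _ ⟨b, rfl, hb, -⟩
      exact ⟨neg_nonpos.2 hb, hb⟩

end Archimedean

/-- An Archimedean vector lattice is atomic iff it is order locally
pre-compact. -/
theorem atomic_iff_orderLocallyPreCompact
    {F : Type*} [Lattice F] [AddCommGroup F] [Module ℝ F]
    (hadd : ∀ x y z : F, x ≤ y → x + z ≤ y + z)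
    (hsmul : ∀ (t : ℝ) (x : F), 0 ≤ t → 0 ≤ x → 0 ≤ t • x)
    (harch : ∀ x y : F, (∀ n : ℕ, 0 ≤ n • x ∧ n • x ≤ y) → x = 0) :
    (∀ g : F, 0 < g → ∃ a : F, IsVLAtom a ∧ a ≤ g) ↔
      (∀ (G : Filter F) (p : F), OrderConvergesTo G p → ∃ S ∈ G, OrderPreCompact S) := by
  have : IsOrderedAddMonoid F := ⟨fun x y h z => hadd x y z h, fun x y h z => by
    simpa only [add_comm z] using hadd x y z h⟩
  have : IsOrderedModule ℝ F := .of_smul_nonneg fun t ht x hx => hsmul t x ht hx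
  refine ⟨fun hF G p hG => ?_, fun hF g hg =>
    exists_atom_le_of_orderLocallyPreCompact harch hF hg⟩
  obtain ⟨u, v, huv, hG⟩ := hG.exists_Icc_mem
  exact ⟨_, hG, orderPreCompact_Icc_of_atomic harch hF huv⟩
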